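/- Let d, k be positive integers, let α > 0, and let L_0 be such that E[P_d(L) − P_0(L)] ≥ α·√(L/k) holds for all integers L ≥ L_0. Then γ_{k,ε} ≥ 1 − d·ε²·(1 + 4ε)/α² for every ε with 0 < ε < min(1/20, α·√(k/(2L_0))). -/

import Mathlib

open Filter

/-- Length of a longest common subsequence of two words (words are lists of naturals). -/
noncomputable def LCSlen (w w' : List ℕ) : ℕ :=
  sSup {n | ∃ u : List ℕ, u.Sublist w ∧ u.Sublist w' ∧ u.length = n}

/-- Expected LCS length of two independent uniformly random words of lengths `n` and `m`
over the alphabet `[k] = {1, …, k}`. -/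
noncomputable def expLCS (k n m : ℕ) : ℝ :=
  (∑ u : Fin n → Fin k, ∑ v : Fin m → Fin k,
      (LCSlen (List.ofFn fun i => (u i : ℕ) + 1) (List.ofFn fun i => (v i : ℕ) + 1) : ℝ)) /
    ((k : ℝ) ^ n * (k : ℝ) ^ m)

/-- `u` is `d`-almost contained in `v`: one may remove at most `d` symbols from `u`
and obtain a subsequence of `v`. -/
def AlmostIn (d : ℕ) (u v : List ℕ) : Prop :=
  ∃ s : List ℕ, s.Sublist u ∧ u.length ≤ s.length + d ∧ s.Sublist v

/-- The length-`m` prefix of an infinite word `w : ℕ → ℕ`. -/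
def pre (w : ℕ → ℕ) (m : ℕ) : List ℕ :=
  (List.range m).map w

/-- `Pd d L w w'` is `P_d(L)`: the length of the longest prefix of the infinite word `w`
that is `d`-almost contained in the length-`L` prefix of `w'`. -/
noncomputable def Pd (d L : ℕ) (w w' : ℕ → ℕ) : ℕ :=
  sSup {m | AlmostIn d (pre w m) (pre w' L)}

/-- Expectation of `f(w, w')` for independent uniformly random infinite words `w, w'` over the
alphabet `[k] = {1, …, k}`, for a function `f` depending only on the first `N` symbols of `w`
and the first `N'` symbols of `w'` (positions beyond the cutoffs are padded with the symbol
`1`, which such an `f` never reads). -/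
noncomputable def EE (k N N' : ℕ) (f : (ℕ → ℕ) → (ℕ → ℕ) → ℝ) : ℝ :=
  (∑ u : Fin N → Fin k, ∑ v : Fin N' → Fin k,
      f (fun i => if h : i < N then (u ⟨i, h⟩ : ℕ) + 1 else 1)
        (fun i => if h : i < N' then (v ⟨i, h⟩ : ℕ) + 1 else 1)) /
    ((k : ℝ) ^ N * (k : ℝ) ^ N')

/-- The average of `f` over all words of length `n` over the alphabet `Fin k`. -/
noncomputable def wordAvg (k : ℕ) : ℕ → (List (Fin k) → ℝ) → ℝ
  | 0, f => f []
  | n + 1, f => (∑ a : Fin k, wordAvg k n fun w => f (a :: w)) / k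

theorem wordAvg_eq_sum (k : ℕ) : ∀ (n : ℕ) (f : List (Fin k) → ℝ),
    wordAvg k n f = (∑ u : Fin n → Fin k, f (List.ofFn u)) / (k : ℝ) ^ n
  | 0, f => by simp [wordAvg]
  | n + 1, f => by
    rw [wordAvg, ← Equiv.sum_comp (Fin.consEquiv fun _ : Fin (n + 1) => Fin k)
      fun u : Fin (n + 1) → Fin k => f (List.ofFn u), Fintype.sum_prod_type,
      pow_succ, ← div_div, Finset.sum_div _ _ ((k : ℝ) ^ n)]
    congr 1
    refine Finset.sum_congr rfl fun a _ => ?_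
    rw [wordAvg_eq_sum k n]
    simp [Fin.consEquiv, List.ofFn_succ]

theorem wordAvg_mono {k : ℕ} : ∀ {n : ℕ} {f g : List (Fin k) → ℝ},
    (∀ w, w.length = n → f w ≤ g w) → wordAvg k n f ≤ wordAvg k n g
  | 0, f, g, h => h [] rfl
  | n + 1, f, g, h => by
    rw [wordAvg, wordAvg]
    gcongr with a
    exact wordAvg_mono fun w hw => h _ (by simp [hw])

theorem wordAvg_congr {k n : ℕ} {f g : List (Fin k) → ℝ}
    (h : ∀ w, w.length = n → f w = g w) : wordAvg k n f = wordAvg k n g :=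
  le_antisymm (wordAvg_mono fun w hw => (h w hw).le) (wordAvg_mono fun w hw => (h w hw).ge)

theorem wordAvg_affine {k : ℕ} (hk : 1 ≤ k) (n : ℕ) (a b : ℝ) (f : List (Fin k) → ℝ) :
    wordAvg k n (fun w => a + b * f w) = a + b * wordAvg k n f := by
  have : (k : ℝ) ≠ 0 := by positivity
  simp only [wordAvg_eq_sum, Finset.sum_add_distrib, ← Finset.mul_sum]
  simp only [Finset.sum_const, Finset.card_univ, Fintype.card_fun, Fintype.card_fin, nsmul_eq_mul]
  push_cast
  field_simp

theorem wordAvg_const {k : ℕ} (hk : 1 ≤ k) (n : ℕ) (a : ℝ) :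
    wordAvg k n (fun _ => a) = a := by
  simpa using wordAvg_affine hk n a 0 fun _ => 0

theorem wordAvg_add (k n : ℕ) (f g : List (Fin k) → ℝ) :
    wordAvg k n (fun w => f w + g w) = wordAvg k n f + wordAvg k n g := by
  simp only [wordAvg_eq_sum, Finset.sum_add_distrib, add_div]

theorem wordAvg_append (k : ℕ) : ∀ (n m : ℕ) (f : List (Fin k) → ℝ),
    wordAvg k (n + m) f = wordAvg k n fun w => wordAvg k m fun w' => f (w ++ w')
  | 0, m, f => by simp [wordAvg]
  | n + 1, m, f => by
    rw [Nat.succ_add, wordAvg, wordAvg]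
    simp only [wordAvg_append k n m, List.cons_append]

theorem wordAvg_comm (k n m : ℕ) (f : List (Fin k) → List (Fin k) → ℝ) :
    wordAvg k n (fun w => wordAvg k m fun v => f w v) =
      wordAvg k m fun v => wordAvg k n fun w => f w v := by
  simp only [wordAvg_eq_sum, ← Finset.sum_div]
  rw [Finset.sum_comm, div_right_comm]

theorem wordAvg_map_perm {k : ℕ} (σ : Equiv.Perm (Fin k)) : ∀ (n : ℕ) (f : List (Fin k) → ℝ),
    wordAvg k n (fun w => f (w.map σ)) = wordAvg k n f
  | 0, f => by simp [wordAvg]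
  | n + 1, f => by
    rw [wordAvg, wordAvg, ← Equiv.sum_comp σ fun a => wordAvg k n fun w => f (a :: w)]
    congr 1
    refine Finset.sum_congr rfl fun a _ => ?_
    simpa using wordAvg_map_perm σ n fun w => f (σ a :: w)

/-- The embedding of words over `Fin k` into words over `{1, …, k}`. -/
def toWord {k : ℕ} (w : List (Fin k)) : List ℕ := w.map fun i : Fin k => (i : ℕ) + 1

@[simp] theorem length_toWord {k : ℕ} (w : List (Fin k)) : (toWord w).length = w.length := by
  simp [toWord]

theorem toWord_append {k : ℕ} (w v : List (Fin k)) : toWord (w ++ v) = toWord w ++ toWord v := by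
  simp [toWord]

theorem toWord_injective (k : ℕ) : Function.Injective (toWord (k := k)) :=
  List.map_injective_iff.2 fun a b h => Fin.ext (by simpa using h)

theorem length_le_LCSlen {u w v : List ℕ} (hw : u.Sublist w) (hv : u.Sublist v) :
    u.length ≤ LCSlen w v := by
  refine le_csSup ⟨w.length, ?_⟩ ⟨u, hw, hv, rfl⟩
  rintro _ ⟨x, hx, -, rfl⟩
  exact hx.length_le

theorem exists_sublist_length_eq_LCSlen (w v : List ℕ) :
    ∃ u : List ℕ, u.Sublist w ∧ u.Sublist v ∧ u.length = LCSlen w v := by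
  refine Nat.sSup_mem (s := {n | ∃ u : List ℕ, u.Sublist w ∧ u.Sublist v ∧ u.length = n})
    ⟨0, [], by simp⟩ ⟨w.length, ?_⟩
  rintro _ ⟨x, hx, -, rfl⟩
  exact hx.length_le

theorem LCSlen_mono {w w' v v' : List ℕ} (hw : w.Sublist w') (hv : v.Sublist v') :
    LCSlen w v ≤ LCSlen w' v' := by
  obtain ⟨u, h1, h2, h3⟩ := exists_sublist_length_eq_LCSlen w v
  exact h3 ▸ length_le_LCSlen (h1.trans hw) (h2.trans hv)

theorem LCSlen_append_le (w w' v v' : List ℕ) :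
    LCSlen w v + LCSlen w' v' ≤ LCSlen (w ++ w') (v ++ v') := by
  obtain ⟨u, h1, h2, h3⟩ := exists_sublist_length_eq_LCSlen w v
  obtain ⟨u', h1', h2', h3'⟩ := exists_sublist_length_eq_LCSlen w' v'
  rw [← h3, ← h3', ← List.length_append]
  exact length_le_LCSlen (h1.append h1') (h2.append h2')

theorem LCSlen_toWord_le_map {k : ℕ} (σ : Fin k → Fin k) (w v : List (Fin k)) :
    LCSlen (toWord w) (toWord v) ≤ LCSlen (toWord (w.map σ)) (toWord (v.map σ)) := by
  obtain ⟨u, h1, h2, h3⟩ := exists_sublist_length_eq_LCSlen (toWord w) (toWord v)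
  obtain ⟨x, hx, rfl⟩ := List.sublist_map_iff.1 h1
  obtain ⟨y, hy, hxy⟩ := List.sublist_map_iff.1 h2
  obtain rfl : x = y := toWord_injective k hxy
  rw [← h3]
  simpa [toWord] using length_le_LCSlen (u := toWord (x.map σ))
    (((hx.map σ).map _)) (((hy.map σ).map _))

theorem LCSlen_toWord_map_perm {k : ℕ} (σ : Equiv.Perm (Fin k)) (w v : List (Fin k)) :
    LCSlen (toWord (w.map σ)) (toWord (v.map σ)) = LCSlen (toWord w) (toWord v) := by
  refine le_antisymm ?_ (LCSlen_toWord_le_map σ w v)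
  simpa using LCSlen_toWord_le_map σ.symm (w.map σ) (v.map σ)

/-- The expected length of a longest common subsequence of `w` and a random word of length `m`. -/
noncomputable def avgLCS {k : ℕ} (m : ℕ) (w : List (Fin k)) : ℝ :=
  wordAvg k m fun v => (LCSlen (toWord w) (toWord v) : ℝ)

theorem expLCS_eq_wordAvg (k n m : ℕ) : expLCS k n m = wordAvg k n (avgLCS m) := by
  unfold expLCS avgLCS
  simp only [wordAvg_eq_sum, ← Finset.sum_div, div_div, toWord, List.map_ofFn]
  rw [mul_comm]
  rfl

theorem avgLCS_map_perm {k : ℕ} (σ : Equiv.Perm (Fin k)) (m : ℕ) (w : List (Fin k)) :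
    avgLCS m (w.map σ) = avgLCS m w := by
  unfold avgLCS
  rw [← wordAvg_map_perm σ]
  simp only [LCSlen_toWord_map_perm]

theorem wordAvg_avgLCS_cons {k : ℕ} (m n : ℕ) (a : Fin k) :
    wordAvg k n (fun w => avgLCS m (a :: w)) = expLCS k (n + 1) m := by
  have h (b : Fin k) : wordAvg k n (fun w => avgLCS m (b :: w)) =
      wordAvg k n (fun w => avgLCS m (a :: w)) := by
    rw [← wordAvg_map_perm (Equiv.swap a b)]
    congr 1
    ext w
    rw [← avgLCS_map_perm (Equiv.swap a b) m (a :: w)]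
    simp
  have hk : (k : ℝ) ≠ 0 := by
    have := a.pos
    positivity
  rw [expLCS_eq_wordAvg, wordAvg]
  simp [h, hk]

theorem expLCS_nonneg (k n m : ℕ) : 0 ≤ expLCS k n m := by
  unfold expLCS
  positivity

theorem expLCS_mono {k n n' m m' : ℕ} (hk : 1 ≤ k) (hn : n ≤ n') (hm : m ≤ m') :
    expLCS k n m ≤ expLCS k n' m' := by
  obtain ⟨r, rfl⟩ := Nat.exists_eq_add_of_le hn
  obtain ⟨s, rfl⟩ := Nat.exists_eq_add_of_le hm
  simp only [expLCS_eq_wordAvg, wordAvg_append]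
  refine wordAvg_mono fun w _ => ?_
  simp only [avgLCS, wordAvg_append]
  rw [← wordAvg_const hk r (wordAvg k m fun v => (LCSlen (toWord w) (toWord v) : ℝ))]
  refine wordAvg_mono fun w' _ => wordAvg_mono fun v _ => ?_
  rw [← wordAvg_const hk s (LCSlen (toWord w) (toWord v) : ℝ)]
  refine wordAvg_mono fun v' _ => ?_
  simp only [toWord_append]
  exact_mod_cast LCSlen_mono (List.sublist_append_left _ _) (List.sublist_append_left _ _)

open Classical in
/-- The number of symbols that can be read from a word while every nonempty prefix read so far
satisfies `Q`. -/
noncomputable def stopLen {α : Type*} : List α → (List α → Prop) → ℕ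
  | [], _ => 0
  | a :: w, Q => if Q [a] then stopLen w (fun x => Q (a :: x)) + 1 else 0

theorem stopLen_le_length {α : Type*} : ∀ (w : List α) (Q : List α → Prop),
    stopLen w Q ≤ w.length
  | [], _ => le_rfl
  | a :: w, Q => by
    rw [stopLen]
    split_ifs
    · simpa using stopLen_le_length w _
    · simp

theorem stopLen_take {α : Type*} : ∀ (w : List α) (Q : List α → Prop), Q [] →
    Q (w.take (stopLen w Q))
  | [], _, h => by simpa using h
  | a :: w, Q, h => by
    rw [stopLen]
    split_ifs with hQ
    · exact stopLen_take w (fun x => Q (a :: x)) hQ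
    · simpa using h

theorem le_stopLen {α : Type*} : ∀ (w : List α) (Q : List α → Prop),
    (∀ x y, Q (x ++ y) → Q x) → ∀ m ≤ w.length, Q (w.take m) → m ≤ stopLen w Q
  | [], _, _, m, hm, _ => hm.trans (Nat.zero_le _)
  | a :: w, Q, hQ, 0, _, _ => Nat.zero_le _
  | a :: w, Q, hQ, m + 1, hm, h => by
    rw [List.take_succ_cons] at h
    rw [stopLen, if_pos (hQ [a] (w.take m) (by simpa using h))]
    exact Nat.succ_le_succ (le_stopLen w (fun x => Q (a :: x)) (fun x y => hQ (a :: x) y) m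
      (by simpa using hm) h)

/-- Stopping at a prefix rule leaves a remainder whose first symbol alone may be biased; if `H` is
insensitive to its first symbol on average, then it sees the remainder as a fresh random word. -/
theorem wordAvg_drop_stopLen {k : ℕ} (H : List (Fin k) → ℝ) (F : ℕ → ℝ) (h0 : H [] = F 0)
    (hF : ∀ n a, wordAvg k n (fun w => H (a :: w)) = F (n + 1)) (hk : 1 ≤ k) :
    ∀ (n : ℕ) (Q : List (Fin k) → Prop),
      wordAvg k n (fun w => H (w.drop (stopLen w Q))) = wordAvg k n fun w => F (n - stopLen w Q)
  | 0, Q => by simpa [wordAvg, stopLen] using h0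
  | n + 1, Q => by
    rw [wordAvg, wordAvg]
    congr 1
    refine Finset.sum_congr rfl fun a _ => ?_
    by_cases h : Q [a]
    · simpa [stopLen, h] using wordAvg_drop_stopLen H F h0 hF hk n fun x => Q (a :: x)
    · simp [stopLen, h, hF, wordAvg_const hk]

/-- The length of the longest prefix of `w` that is `d`-almost contained in `v`. -/
noncomputable def prefLen {k : ℕ} (d : ℕ) (w v : List (Fin k)) : ℕ :=
  stopLen w fun x => AlmostIn d (toWord x) (toWord v)

theorem AlmostIn.length_le {d : ℕ} {u v : List ℕ} (h : AlmostIn d u v) :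
    u.length ≤ v.length + d := by
  obtain ⟨s, -, h2, h3⟩ := h
  have := h3.length_le
  omega

theorem AlmostIn.of_append {d : ℕ} {x y v : List ℕ} (h : AlmostIn d (x ++ y) v) :
    AlmostIn d x v := by
  obtain ⟨s, h1, h2, h3⟩ := h
  obtain ⟨s₁, s₂, rfl, hs₁, hs₂⟩ := List.sublist_append_iff.1 h1
  refine ⟨s₁, hs₁, ?_, (List.sublist_append_left _ _).trans h3⟩
  have := hs₂.length_le
  simp only [List.length_append] at h2
  omega

theorem almostIn_take_prefLen {k : ℕ} (d : ℕ) (w v : List (Fin k)) :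
    AlmostIn d (toWord (w.take (prefLen d w v))) (toWord v) :=
  stopLen_take w (fun x => AlmostIn d (toWord x) (toWord v)) ⟨[], by simp [toWord]⟩

theorem prefLen_le_length {k : ℕ} (d : ℕ) (w v : List (Fin k)) : prefLen d w v ≤ w.length :=
  stopLen_le_length _ _

theorem prefLen_le {k : ℕ} (d : ℕ) (w v : List (Fin k)) : prefLen d w v ≤ v.length + d := by
  have := (almostIn_take_prefLen d w v).length_le
  have := prefLen_le_length d w v
  simp at *
  omega

theorem le_prefLen {k d m : ℕ} {w v : List (Fin k)} (hm : m ≤ w.length)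
    (h : AlmostIn d (toWord (w.take m)) (toWord v)) : m ≤ prefLen d w v :=
  le_stopLen w (fun x => AlmostIn d (toWord x) (toWord v))
    (fun x y hxy => AlmostIn.of_append (y := toWord y) (toWord_append x y ▸ hxy)) m hm h

theorem prefLen_append {k d : ℕ} {w v : List (Fin k)} (w' : List (Fin k))
    (h : v.length + d ≤ w.length) : prefLen d (w ++ w') v = prefLen d w v := by
  have h1 := (prefLen_le d (w ++ w') v).trans h
  have h2 := prefLen_le_length d w v
  refine le_antisymm (le_prefLen h1 ?_) (le_prefLen (h2.trans (by simp)) ?_)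
  · rw [← List.take_append_of_le_length (l₂ := w') h1]
    exact almostIn_take_prefLen d (w ++ w') v
  · rw [List.take_append_of_le_length h2]
    exact almostIn_take_prefLen d w v

/-- The expectation of `P_d(L)`. -/
noncomputable def avgPref (k d L : ℕ) : ℝ :=
  wordAvg k L fun v => wordAvg k (L + d) fun w => (prefLen d w v : ℝ)

theorem wordAvg_prefLen {k d L N : ℕ} (hk : 1 ≤ k) (hN : L + d ≤ N) :
    wordAvg k L (fun v => wordAvg k N fun w => (prefLen d w v : ℝ)) = avgPref k d L := by
  obtain ⟨r, rfl⟩ := Nat.exists_eq_add_of_le hN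
  refine wordAvg_congr fun v hv => ?_
  rw [wordAvg_append]
  refine wordAvg_congr fun w hw => ?_
  rw [← wordAvg_const hk r (prefLen d w v : ℝ)]
  refine wordAvg_congr fun w' _ => ?_
  rw [prefLen_append w' (by omega)]

theorem avgPref_nonneg (k d L : ℕ) : 0 ≤ avgPref k d L := by
  unfold avgPref
  simp only [wordAvg_eq_sum]
  positivity

theorem avgPref_le {k : ℕ} (hk : 1 ≤ k) (d L : ℕ) : avgPref k d L ≤ L + d := by
  rw [← wordAvg_const hk L ((L : ℝ) + d)]
  refine wordAvg_mono fun v hv => ?_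
  rw [← wordAvg_const hk (L + d) ((L : ℝ) + d)]
  refine wordAvg_mono fun w _ => ?_
  rw [← hv]
  exact_mod_cast prefLen_le d w v

/-- The length of the prefix of `w` matched greedily in `v`. -/
def greedyLen {k : ℕ} : List (Fin k) → List (Fin k) → ℕ
  | _, [] => 0
  | [], _ :: _ => 0
  | a :: w, b :: v => if b = a then greedyLen w v + 1 else greedyLen (a :: w) v

theorem take_greedyLen_sublist {k : ℕ} : ∀ (w v : List (Fin k)),
    (w.take (greedyLen w v)).Sublist v ∧ greedyLen w v ≤ w.length
  | _, [] => by simp [greedyLen]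
  | [], _ :: _ => by simp [greedyLen]
  | a :: w, b :: v => by
    rw [greedyLen]
    split_ifs with h
    · subst h
      have := take_greedyLen_sublist w v
      simpa using this
    · have := take_greedyLen_sublist (a :: w) v
      exact ⟨this.1.cons b, this.2⟩

theorem greedyLen_le_prefLen {k : ℕ} (d : ℕ) (w v : List (Fin k)) :
    greedyLen w v ≤ prefLen d w v := by
  obtain ⟨h1, h2⟩ := take_greedyLen_sublist w v
  exact le_prefLen h2 ⟨_, List.Sublist.refl _, by simp, h1.map _⟩

theorem wordAvg_greedyLen {k : ℕ} (hk : 1 ≤ k) : ∀ (L : ℕ) (w : List (Fin k)), L ≤ w.length →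
    wordAvg k L (fun v => (greedyLen w v : ℝ)) = L / k
  | 0, w, _ => by simp [wordAvg, greedyLen]
  | L + 1, [], h => by simp at h
  | L + 1, a :: w, h => by
    have hb (b : Fin k) : wordAvg k L (fun v => (greedyLen (a :: w) (b :: v) : ℝ)) =
        L / k + if b = a then 1 else 0 := by
      split_ifs with hba
      · have := wordAvg_affine hk L 1 1 fun v => (greedyLen w v : ℝ)
        rw [wordAvg_greedyLen hk L w (by simpa using h)] at this
        simp only [greedyLen, hba, if_true]
        push_cast
        simpa [add_comm] using this
      · simpa [greedyLen, hba] using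
          wordAvg_greedyLen hk L (a :: w) (by simp at h ⊢; omega)
    have : (k : ℝ) ≠ 0 := by positivity
    rw [wordAvg]
    simp only [hb, Finset.sum_add_distrib]
    simp
    field_simp

theorem div_le_avgPref_zero {k : ℕ} (hk : 1 ≤ k) (L : ℕ) : (L : ℝ) / k ≤ avgPref k 0 L := by
  rw [avgPref, wordAvg_comm, ← wordAvg_const hk (L + 0) ((L : ℝ) / k)]
  refine wordAvg_mono fun w hw => ?_
  rw [← wordAvg_greedyLen hk L w (by omega)]
  exact wordAvg_mono fun v _ => by exact_mod_cast greedyLen_le_prefLen 0 w v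

theorem pre_eq_toWord_take {k N m : ℕ} (u : Fin N → Fin k) (hm : m ≤ N) :
    pre (fun i => if h : i < N then (u ⟨i, h⟩ : ℕ) + 1 else 1) m =
      toWord ((List.ofFn u).take m) := by
  refine List.ext_getElem (by simp [pre, hm]) fun i h1 h2 => ?_
  have : i < m := by simpa [pre] using h1
  simp [pre, toWord, show i < N by omega]

theorem Pd_eq_prefLen {k N L d : ℕ} (hN : L + d ≤ N) (u : Fin N → Fin k) (v : Fin L → Fin k) :
    Pd d L (fun i => if h : i < N then (u ⟨i, h⟩ : ℕ) + 1 else 1)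
        (fun i => if h : i < L then (v ⟨i, h⟩ : ℕ) + 1 else 1) =
      prefLen d (List.ofFn u) (List.ofFn v) := by
  have hv := pre_eq_toWord_take v le_rfl
  rw [List.take_of_length_le (by simp)] at hv
  refine IsGreatest.csSup_eq ⟨?_, fun m hm => ?_⟩
  · have := prefLen_le_length d (List.ofFn u) (List.ofFn v)
    rw [Set.mem_ofPred_eq, hv, pre_eq_toWord_take u (by simpa using this)]
    exact almostIn_take_prefLen d _ _
  · rw [Set.mem_ofPred_eq, hv] at hm
    have hmN : m ≤ N := by
      have := hm.length_le
      simp [pre] at this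
      omega
    rw [pre_eq_toWord_take u hmN] at hm
    exact le_prefLen (by simpa using hmN) hm

theorem EE_Pd_sub {k : ℕ} (hk : 1 ≤ k) (d L : ℕ) :
    EE k (L + d) L (fun w w' => (Pd d L w w' : ℝ) - (Pd 0 L w w' : ℝ)) =
      avgPref k d L - avgPref k 0 L := by
  rw [← wordAvg_prefLen hk (N := L + d) (d := 0) (by omega), avgPref, wordAvg_comm,
    wordAvg_comm k L]
  unfold EE
  simp only [wordAvg_eq_sum, ← Finset.sum_div, ← sub_div, ← Finset.sum_sub_distrib, div_div]
  rw [mul_comm]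
  congr 1
  refine Finset.sum_congr rfl fun u _ => Finset.sum_congr rfl fun v _ => ?_
  rw [Pd_eq_prefLen le_rfl, Pd_eq_prefLen (by omega)]

theorem prefLen_add_LCSlen_le {k : ℕ} (d : ℕ) (w v v' : List (Fin k)) :
    (prefLen d w v : ℝ) - d + LCSlen (toWord (w.drop (prefLen d w v))) (toWord v') ≤
      LCSlen (toWord w) (toWord (v ++ v')) := by
  obtain ⟨s, h1, h2, h3⟩ := almostIn_take_prefLen d w v
  have h4 := LCSlen_append_le (toWord (w.take (prefLen d w v)))
    (toWord (w.drop (prefLen d w v))) (toWord v) (toWord v')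
  rw [← toWord_append, ← toWord_append, List.take_append_drop] at h4
  have h5 := length_le_LCSlen h1 h3
  have h6 := prefLen_le_length d w v
  have h7 : prefLen d w v + LCSlen (toWord (w.drop (prefLen d w v))) (toWord v') ≤
      LCSlen (toWord w) (toWord (v ++ v')) + d := by
    simp at h2
    omega
  have : ((prefLen d w v + LCSlen (toWord (w.drop (prefLen d w v))) (toWord v') : ℕ) : ℝ) ≤
      ((LCSlen (toWord w) (toWord (v ++ v')) + d : ℕ) : ℝ) := by exact_mod_cast h7
  push_cast at this
  linarith

theorem wordAvg_prefLen_le_expLCS {k : ℕ} (hk : 1 ≤ k) (d L m n : ℕ) :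
    (wordAvg k L fun v => wordAvg k n fun w =>
      (prefLen d w v : ℝ) - d + expLCS k (n - prefLen d w v) m) ≤ expLCS k n (L + m) := by
  have hsplit : expLCS k n (L + m) = wordAvg k L fun v => wordAvg k n fun w =>
      wordAvg k m fun v' => (LCSlen (toWord w) (toWord (v ++ v')) : ℝ) := by
    rw [expLCS_eq_wordAvg, wordAvg_comm]
    exact wordAvg_congr fun w _ => wordAvg_append k L m _
  rw [hsplit]
  refine wordAvg_mono fun v _ => ?_
  have h := wordAvg_drop_stopLen (avgLCS (k := k) m) (fun r => expLCS k r m)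
    (by rw [expLCS_eq_wordAvg]; rfl) (fun r a => wordAvg_avgLCS_cons m r a) hk n
    (fun x => AlmostIn d (toWord x) (toWord v))
  have h' : (wordAvg k n fun w => (prefLen d w v : ℝ) - d + expLCS k (n - prefLen d w v) m) =
      wordAvg k n fun w => (prefLen d w v : ℝ) - d + avgLCS m (w.drop (prefLen d w v)) := by
    rw [wordAvg_add, wordAvg_add]
    exact congrArg _ h.symm
  rw [h']
  refine wordAvg_mono fun w _ => ?_
  have := wordAvg_affine hk m ((prefLen d w v : ℝ) - d) 1
    fun v' => (LCSlen (toWord (w.drop (prefLen d w v))) (toWord v') : ℝ)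
  rw [one_mul] at this
  unfold avgLCS
  rw [← this]
  refine wordAvg_mono fun v' _ => ?_
  rw [one_mul]
  exact prefLen_add_LCSlen_le d w v v'

/-- A lower bound for the expected LCS obtained by matching `t` blocks of length `L` one after the
other, with a quadratic penalty controlling the fluctuations. -/
theorem le_expLCS_mul {k : ℕ} (hk : 1 ≤ k) (d L : ℕ) {c : ℝ} (hc : 0 < c) (t : ℕ) : ∀ n : ℕ,
    (n : ℝ) - d * t - ((n - t * avgPref k d L + c) ^ 2 + t * ((L : ℝ) + d) ^ 2) / (4 * c)
      - (L + d) ≤ expLCS k n (t * L) := by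
  induction t with
  | zero =>
    intro n
    refine le_trans ?_ (expLCS_nonneg _ _ _)
    have : (n : ℝ) ≤ (n + c) ^ 2 / (4 * c) := by
      rw [le_div_iff₀ (by positivity)]
      nlinarith [sq_nonneg ((n : ℝ) - c)]
    simp only [Nat.cast_zero, zero_mul, mul_zero, sub_zero, add_zero]
    have h1 : (0 : ℝ) ≤ L := by positivity
    have h2 : (0 : ℝ) ≤ d := by positivity
    linarith
  | succ t ih =>
    intro n
    by_cases hn : n < L + d
    · refine le_trans ?_ (expLCS_nonneg _ _ _)
      have h1 : (n : ℝ) ≤ L + d := by exact_mod_cast hn.le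
      have h2 : 0 ≤ (((n : ℝ) - (t + 1 : ℕ) * avgPref k d L + c) ^ 2 +
          (t + 1 : ℕ) * ((L : ℝ) + d) ^ 2) / (4 * c) := by positivity
      have h3 : (0 : ℝ) ≤ d * (t + 1 : ℕ) := by positivity
      linarith
    push Not at hn
    rw [show (t + 1) * L = L + t * L by ring]
    refine le_trans ?_ (wordAvg_prefLen_le_expLCS hk d L (t * L) n)
    set μ := avgPref k d L with hμ
    have hμ0 : 0 ≤ μ := avgPref_nonneg k d L
    have hμ1 : μ ≤ L + d := avgPref_le hk d L
    set y : ℝ := n - (t + 1) * μ + c with hy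
    have key : wordAvg k L (fun v => wordAvg k n fun w =>
        (n - d * (t + 1) - (y ^ 2 + 2 * y * μ + (t + 1) * ((L : ℝ) + d) ^ 2) / (4 * c) - (L + d))
          + (2 * y / (4 * c)) * (prefLen d w v : ℝ)) =
        (n - d * (t + 1) - (y ^ 2 + 2 * y * μ + (t + 1) * ((L : ℝ) + d) ^ 2) / (4 * c) - (L + d))
          + (2 * y / (4 * c)) * μ := by
      simp only [wordAvg_affine hk]
      rw [wordAvg_prefLen hk hn]
    calc _ = _ := by
          push_cast
          field_simp
          ring
      _ ≤ _ := key.ge.trans (wordAvg_mono fun v hv => wordAvg_mono fun w hw => ?_)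
    have hJ1 : prefLen d w v ≤ n := hw ▸ prefLen_le_length d w v
    have hJ2 : (prefLen d w v : ℝ) ≤ L + d := by
      rw [← hv]
      exact_mod_cast prefLen_le d w v
    have hJ0 : (0 : ℝ) ≤ prefLen d w v := by positivity
    have h := ih (n - prefLen d w v)
    rw [Nat.cast_sub hJ1] at h
    set J : ℝ := (prefLen d w v : ℝ)
    have hsq : (J - μ) ^ 2 ≤ ((L : ℝ) + d) ^ 2 :=
      sq_le_sq' (by linarith) (by linarith)
    have hle : ((n : ℝ) - J - t * μ + c) ^ 2 + t * ((L : ℝ) + d) ^ 2 ≤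
        y ^ 2 + 2 * y * μ + (t + 1) * ((L : ℝ) + d) ^ 2 - 2 * y * J := by
      have : (n : ℝ) - J - t * μ + c = y - (J - μ) := by rw [hy]; ring
      rw [this]
      nlinarith
    have hdiv := div_le_div_of_nonneg_right hle (show 0 ≤ 4 * c by positivity)
    rw [sub_div, mul_div_right_comm] at hdiv
    linarith

/-- Any block rate `τ` compatible with the lengths of both words gives a lower bound for `γ`. -/
theorem mul_avgPref_sub_le {k : ℕ} (hk : 1 ≤ k) (d L : ℕ) {ρ γ τ : ℝ} (hτ0 : 0 ≤ τ)
    (hτ1 : τ * avgPref k d L ≤ 1) (hτ2 : τ * L ≤ ρ)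
    (hγ : Tendsto (fun n : ℕ => expLCS k n ⌊ρ * n⌋₊ / n) atTop (nhds γ)) :
    τ * (avgPref k d L - d) ≤ γ := by
  set μ := avgPref k d L with hμ
  have hμ0 : 0 ≤ μ := avgPref_nonneg k d L
  have hc : ∀ c : ℝ, 1 ≤ c → τ * (μ - d) - τ * ((L : ℝ) + d) ^ 2 / (4 * c) ≤ γ := by
    intro c hc
    set K : ℝ := 1 + c + (L + d) with hK
    have ht : Tendsto (fun n : ℕ => ((⌊τ * n⌋₊ : ℝ) / n) * (μ - d - ((L : ℝ) + d) ^ 2 / (4 * c))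
        - K / n) atTop (nhds (τ * (μ - d - ((L : ℝ) + d) ^ 2 / (4 * c)) - 0)) :=
      (((tendsto_nat_floor_mul_div_atTop hτ0).comp tendsto_natCast_atTop_atTop).mul_const _).sub
        (tendsto_const_div_atTop_nhds_zero_nat K)
    have hle := le_of_tendsto_of_tendsto ht hγ ?_
    · calc _ = τ * (μ - d - ((L : ℝ) + d) ^ 2 / (4 * c)) - 0 := by ring
        _ ≤ γ := hle
    filter_upwards [eventually_gt_atTop 0] with n hn
    have hn' : (0 : ℝ) < n := by exact_mod_cast hn
    set t := ⌊τ * n⌋₊ with htdef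
    have htle : (t : ℝ) ≤ τ * n := Nat.floor_le (by positivity)
    have hr0 : 0 ≤ (t : ℝ) * μ := by positivity
    set r := ⌊(t : ℝ) * μ⌋₊ with hrdef
    have hr1 : (r : ℝ) ≤ t * μ := Nat.floor_le hr0
    have hr2 : (t : ℝ) * μ < r + 1 := Nat.lt_floor_add_one _
    have hrn : r ≤ n := by
      have : (r : ℝ) ≤ n := by nlinarith
      exact_mod_cast this
    have hm : t * L ≤ ⌊ρ * n⌋₊ := by
      refine Nat.le_floor ?_
      push_cast
      have : (0 : ℝ) ≤ L := by positivity
      nlinarith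
    have h := (le_expLCS_mul hk d L (by linarith : 0 < c) t r).trans (expLCS_mono hk hrn hm)
    rw [← hμ] at h
    have hsq : ((r : ℝ) - t * μ + c) ^ 2 / (4 * c) ≤ c := by
      rw [div_le_iff₀ (by positivity)]
      nlinarith
    rw [add_div] at h
    rw [div_mul_eq_mul_div, ← sub_div]
    gcongr
    have : (t : ℝ) * (μ - d - ((L : ℝ) + d) ^ 2 / (4 * c)) =
      t * μ - d * t - t * ((L : ℝ) + d) ^ 2 / (4 * c) := by ring
    rw [this]
    linarith
  have hlim : Tendsto (fun c : ℝ => τ * (μ - d) - τ * ((L : ℝ) + d) ^ 2 / (4 * c)) atTop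
      (nhds (τ * (μ - d) - 0)) :=
    tendsto_const_nhds.sub
      (tendsto_const_nhds.div_atTop (tendsto_id.const_mul_atTop (by norm_num)))
  rw [sub_zero] at hlim
  exact le_of_tendsto hlim ((eventually_ge_atTop 1).mono hc)

theorem one_sub_le_gamma {k : ℕ} (hk : 1 ≤ k) {ε γ : ℝ} (hε0 : 0 ≤ ε) (hε1 : ε ≤ 1)
    (hγ : Tendsto (fun n : ℕ => expLCS k n ⌊(1 - ε) * k * n⌋₊ / n) atTop (nhds γ)) :
    1 - ε ≤ γ := by
  have hk0 : (0 : ℝ) < k := by positivity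
  have hμ := div_le_avgPref_zero hk 1
  push_cast at hμ
  have hμ0 : 0 < avgPref k 0 1 := lt_of_lt_of_le (by positivity) hμ
  have hk1 : 1 / avgPref k 0 1 ≤ k := by
    rw [div_le_iff₀ hμ0]
    rw [div_le_iff₀ hk0] at hμ
    linarith
  have h := mul_avgPref_sub_le hk 0 1 (τ := (1 - ε) / avgPref k 0 1)
    (div_nonneg (by linarith) hμ0.le) (by rw [div_mul_cancel₀ _ hμ0.ne']; linarith)
    (by
      rw [div_eq_mul_one_div]
      push_cast
      rw [mul_one]
      exact mul_le_mul_of_nonneg_left hk1 (by linarith)) hγ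
  rwa [Nat.cast_zero, sub_zero, div_mul_cancel₀ _ hμ0.ne'] at h

theorem one_sub_div_le_gamma {k : ℕ} (hk : 1 ≤ k) (d : ℕ) {L : ℕ} (hL : 1 ≤ L) {ρ γ : ℝ}
    (hρ : 0 < ρ) (hμ : L / ρ ≤ avgPref k d L)
    (hγ : Tendsto (fun n : ℕ => expLCS k n ⌊ρ * n⌋₊ / n) atTop (nhds γ)) :
    1 - d * ρ / L ≤ γ := by
  have hL0 : (0 : ℝ) < L := by positivity
  have hμ0 : 0 < avgPref k d L := lt_of_lt_of_le (by positivity) hμ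
  have h1 : 1 / avgPref k d L ≤ ρ / L := by
    rw [← one_div_div (L : ℝ) ρ]
    exact one_div_le_one_div_of_le (by positivity) hμ
  have h := mul_avgPref_sub_le hk d L (τ := 1 / avgPref k d L) (by positivity)
    (by rw [one_div_mul_cancel hμ0.ne'])
    ((mul_le_mul_of_nonneg_right h1 hL0.le).trans_eq (div_mul_cancel₀ _ hL0.ne')) hγ
  rw [mul_sub, one_div_mul_cancel hμ0.ne'] at h
  have h2 := mul_le_mul_of_nonneg_right h1 (show (0 : ℝ) ≤ d by positivity)
  have h3 : ρ / L * d = d * ρ / L := by ring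
  linarith

/-- Let `d, k ≥ 1`, `α > 0` and `L₀` be such that
`E[P_d(L) − P_0(L)] ≥ α √(L/k)` for all `L ≥ L₀`.  Then
`γ_{k,ε} ≥ 1 − d ε² (1 + 4ε)/α²` for every `ε` with
`0 < ε < min(1/20, α √(k/(2L₀)))`.  (Here `γ_{k,ε}` is the limit of
`(1/n) E[LCS(w, w')]` for `w ~ [k]^n`, `w' ~ [k]^{⌊(1-ε)kn⌋}`; since `P_d(L) ≤ L + d`
always, `E[P_d(L) − P_0(L)]` is computed by `EE k (L+d) L`.) -/
theorem stmt7 (d k : ℕ) (hd : 1 ≤ d) (hk : 1 ≤ k) (α : ℝ) (hα : 0 < α) (L₀ : ℕ)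
    (hdrift : ∀ L : ℕ, L₀ ≤ L →
      α * Real.sqrt ((L : ℝ) / k) ≤
        EE k (L + d) L (fun w w' => (Pd d L w w' : ℝ) - (Pd 0 L w w' : ℝ)))
    (ε : ℝ) (hε0 : 0 < ε)
    (hε1 : ε < min (1 / 20) (α * Real.sqrt ((k : ℝ) / (2 * L₀))))
    (γ : ℝ)
    (hγ : Tendsto (fun n : ℕ => expLCS k n ⌊(1 - ε) * k * n⌋₊ / n) atTop (nhds γ)) :
    1 - d * ε ^ 2 * (1 + 4 * ε) / α ^ 2 ≤ γ := by
  have hk0 : (0 : ℝ) < k := by positivity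
  have hd1 : (1 : ℝ) ≤ d := by exact_mod_cast hd
  obtain ⟨hε20, hεL⟩ := lt_min_iff.1 hε1
  have hα2 : 0 < α ^ 2 := by positivity
  by_cases hcase : α ^ 2 ≤ d * ε * (1 + 4 * ε)
  · refine le_trans ?_ (one_sub_le_gamma hk hε0.le (by linarith) hγ)
    have : ε ≤ d * ε ^ 2 * (1 + 4 * ε) / α ^ 2 := by
      rw [le_div_iff₀ hα2]
      nlinarith
    linarith
  push Not at hcase
  have hL₀ : 1 ≤ L₀ := by
    by_contra h
    obtain rfl : L₀ = 0 := by omega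
    simp at hεL
    linarith
  have hL₀' : (0 : ℝ) < L₀ := by positivity
  have hsq : ε ^ 2 * (2 * L₀) < α ^ 2 * k := by
    have h := pow_lt_pow_left₀ hεL hε0.le two_ne_zero
    rw [mul_pow, Real.sq_sqrt (by positivity), ← mul_div_assoc, lt_div_iff₀ (by positivity)] at h
    exact h
  set X : ℝ := α ^ 2 * k * (1 - ε) ^ 2 / ε ^ 2 with hX
  have hXε : X * ε ^ 2 = α ^ 2 * k * (1 - ε) ^ 2 := div_mul_cancel₀ _ (by positivity)
  have hX0 : 0 ≤ X := by positivity
  have h1ε : (9 / 10 : ℝ) ≤ (1 - ε) ^ 2 := by nlinarith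
  set L := ⌊X⌋₊ with hLdef
  have hLX : (L : ℝ) ≤ X := Nat.floor_le hX0
  have hXL : X < L + 1 := Nat.lt_floor_add_one _
  have hLL : L₀ ≤ L := by
    refine Nat.le_floor ?_
    rw [hX, le_div_iff₀ (by positivity)]
    nlinarith [mul_pos hα2 hk0, mul_pos hL₀' (pow_pos hε0 2)]
  have hL1 : 1 ≤ L := hL₀.trans hLL
  have hL0 : (0 : ℝ) < L := by positivity
  have hρ : 0 < (1 - ε) * k := mul_pos (by linarith) hk0
  have hdr := hdrift L hLL
  rw [EE_Pd_sub hk] at hdr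
  have hP0 := div_le_avgPref_zero hk L
  set s := Real.sqrt ((L : ℝ) / k) with hs
  have hs0 : 0 ≤ s := Real.sqrt_nonneg _
  have hss : s ^ 2 = L / k := Real.sq_sqrt (by positivity)
  have hsα : s * ε ≤ α * (1 - ε) := by
    refine le_of_sq_le_sq ?_ (mul_nonneg hα.le (by linarith))
    rw [mul_pow, mul_pow, hss, div_mul_eq_mul_div, div_le_iff₀ hk0]
    nlinarith [mul_le_mul_of_nonneg_right hLX (sq_nonneg ε)]
  have hμ : (L : ℝ) / ((1 - ε) * k) ≤ avgPref k d L := by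
    have : (L : ℝ) / ((1 - ε) * k) ≤ s ^ 2 + α * s := by
      rw [mul_comm, ← div_div, ← hss, div_le_iff₀ (by linarith)]
      nlinarith [mul_le_mul_of_nonneg_left hsα hs0]
    linarith
  refine le_trans ?_ (one_sub_div_le_gamma hk d hL1 hρ hμ hγ)
  have hfin : d * ((1 - ε) * k) / L ≤ d * ε ^ 2 * (1 + 4 * ε) / α ^ 2 := by
    rw [div_le_div_iff₀ hL0 hα2]
    have hk1 : (1 : ℝ) ≤ k := by exact_mod_cast hk
    have hαk : ε * (1 + 4 * ε) ≤ α ^ 2 * k := by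
      have : ε * (1 + 4 * ε) ≤ d * (ε * (1 + 4 * ε)) := le_mul_of_one_le_left (by positivity) hd1
      have : α ^ 2 ≤ α ^ 2 * k := le_mul_of_one_le_right hα2.le hk1
      linarith
    have hgain : 1 ≤ (1 - ε) * (3 - 4 * ε) := by nlinarith
    have hmul : ε ^ 2 * (1 + 4 * ε) ≤ α ^ 2 * k * (ε * ((1 - ε) * (3 - 4 * ε))) := by
      calc ε ^ 2 * (1 + 4 * ε) = ε * (1 + 4 * ε) * (ε * 1) := by ring
        _ ≤ α ^ 2 * k * (ε * ((1 - ε) * (3 - 4 * ε))) := by gcongr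
    have hLow : (X - 1) * (ε ^ 2 * (1 + 4 * ε)) ≤ L * (ε ^ 2 * (1 + 4 * ε)) := by
      gcongr
      linarith
    have hexp : (X - 1) * (ε ^ 2 * (1 + 4 * ε)) =
        α ^ 2 * k * (1 - ε) ^ 2 * (1 + 4 * ε) - ε ^ 2 * (1 + 4 * ε) := by
      rw [← hXε]
      ring
    have hcore : (1 - ε) * k * α ^ 2 ≤ ε ^ 2 * (1 + 4 * ε) * L := by
      rw [hexp] at hLow
      linarith
    calc d * ((1 - ε) * k) * α ^ 2 = d * ((1 - ε) * k * α ^ 2) := by ring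
      _ ≤ d * (ε ^ 2 * (1 + 4 * ε) * L) := by gcongr
      _ = d * ε ^ 2 * (1 + 4 * ε) * L := by ring
  linarith
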